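/- The sequence 0 → ℂ* → 𝒦ₘ → Div₀(ℂ* × ℤ/m) → ℂ* × ℤ/m → 0 is exact, where ℂ* maps to constant tuples, the second map is div, and the third is the summation map Φ. -/

import Mathlib

open Polynomial

/-- The order of vanishing of a rational function at `u = 0`
(positive for zeros, negative for poles). -/
noncomputable def ord0 (g : RatFunc ℂ) : ℤ :=
  (g.num.rootMultiplicity 0 : ℤ) - g.denom.rootMultiplicity 0

/-- The order of vanishing of a rational function at `u = ∞`, i.e. of `g(1/v)` at `v = 0`. -/
noncomputable def ordInf (g : RatFunc ℂ) : ℤ := -g.intDegree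

/-- The leading coefficient of the Laurent expansion of `g` at `u = 0`, i.e. the value of
`g(u)/u^{n₀(g)}` at `u = 0`. -/
noncomputable def c0 (g : RatFunc ℂ) : ℂ :=
  g.num.coeff (g.num.rootMultiplicity 0) / g.denom.coeff (g.denom.rootMultiplicity 0)

/-- The leading coefficient of the Laurent expansion of `g` at `u = ∞`, i.e. the value of
`g(u)·u^{n_∞(g)}` at `u = ∞`. -/
noncomputable def cInf (g : RatFunc ℂ) : ℂ := g.num.leadingCoeff / g.denom.leadingCoeff

/-- The order of vanishing of a rational function at `x`. -/
noncomputable def ordAt (x : ℂ) (g : RatFunc ℂ) : ℤ :=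
  (g.num.rootMultiplicity x : ℤ) - g.denom.rootMultiplicity x

/-- The function group `𝒦ₘ` of an `I_m` fiber: `m`-tuples of nonzero rational functions
with matching orders and leading Laurent coefficients at the nodes, whose orders sum to
zero around the cycle. -/
noncomputable def Kgroup (m : ℕ) [NeZero m] : Set (ZMod m → (RatFunc ℂ)ˣ) :=
  {g | (∀ j, ordInf (g j : RatFunc ℂ) + ord0 (g (j + 1) : RatFunc ℂ) = 0) ∧
       (∀ j, cInf (g j : RatFunc ℂ) = c0 (g (j + 1) : RatFunc ℂ)) ∧
       (∑ j, ord0 (g j : RatFunc ℂ)) = 0}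

/-- The degree of a divisor on `ℂ* × ℤ/m`: the sum of its coefficients. -/
noncomputable def divDeg (m : ℕ) (D : (ℂˣ × Multiplicative (ZMod m)) →₀ ℤ) : ℤ :=
  ∑ pt ∈ D.support, D pt

/-- The summation map `Φ : Div(ℂ* × ℤ/m) → ℂ* × ℤ/m`, sending a formal sum of points to
their actual sum in the group `ℂ* × ℤ/m` (written multiplicatively). -/
noncomputable def Phi (m : ℕ) (D : (ℂˣ × Multiplicative (ZMod m)) →₀ ℤ) :
    ℂˣ × Multiplicative (ZMod m) :=
  ∏ pt ∈ D.support, pt ^ (D pt)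

/-- The constant tuple in `𝒦ₘ` associated to a nonzero constant `c`. -/
noncomputable def constTuple (m : ℕ) (c : ℂˣ) : ZMod m → (RatFunc ℂ)ˣ :=
  fun _ => Units.map (RatFunc.C : ℂ →+* RatFunc ℂ).toMonoidHom c


section Helpers

theorem aux_num_ne (g : (RatFunc ℂ)ˣ) : (g : RatFunc ℂ).num ≠ 0 :=
  RatFunc.num_ne_zero g.ne_zero

theorem aux_ordAt_mul (x : ℂ) (g h : (RatFunc ℂ)ˣ) :
    ordAt x ((g * h : (RatFunc ℂ)ˣ) : RatFunc ℂ) = ordAt x g + ordAt x h := by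
  have key := RatFunc.num_denom_mul (g : RatFunc ℂ) (h : RatFunc ℂ)
  have h1 := congrArg (Polynomial.rootMultiplicity x) key
  have hg := aux_num_ne g
  have hh := aux_num_ne h
  have hgh : ((g : RatFunc ℂ) * (h : RatFunc ℂ)).num ≠ 0 :=
    aux_num_ne (g * h)
  have dg := RatFunc.denom_ne_zero (g : RatFunc ℂ)
  have dh := RatFunc.denom_ne_zero (h : RatFunc ℂ)
  have dgh := RatFunc.denom_ne_zero ((g : RatFunc ℂ) * (h : RatFunc ℂ))
  rw [Polynomial.rootMultiplicity_mul (mul_ne_zero hgh (mul_ne_zero dg dh)),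
    Polynomial.rootMultiplicity_mul (mul_ne_zero dg dh),
    Polynomial.rootMultiplicity_mul (mul_ne_zero (mul_ne_zero hg hh) dgh),
    Polynomial.rootMultiplicity_mul (mul_ne_zero hg hh)] at h1
  simp only [ordAt, Units.val_mul]
  omega

theorem aux_cInf_mul (g h : (RatFunc ℂ)ˣ) :
    cInf ((g * h : (RatFunc ℂ)ˣ) : RatFunc ℂ) = cInf g * cInf h := by
  have key := RatFunc.num_denom_mul (g : RatFunc ℂ) (h : RatFunc ℂ)
  have h1 := congrArg Polynomial.leadingCoeff key
  have dg := Polynomial.leadingCoeff_ne_zero.2 (RatFunc.denom_ne_zero (g : RatFunc ℂ))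
  have dh := Polynomial.leadingCoeff_ne_zero.2 (RatFunc.denom_ne_zero (h : RatFunc ℂ))
  have dgh := Polynomial.leadingCoeff_ne_zero.2 (RatFunc.denom_ne_zero ((g : RatFunc ℂ) * (h : RatFunc ℂ)))
  simp only [Polynomial.leadingCoeff_mul] at h1
  simp only [cInf, Units.val_mul]
  rw [div_mul_div_comm, div_eq_div_iff dgh (mul_ne_zero dg dh)]
  exact h1

theorem aux_c0_eq (g : RatFunc ℂ) : c0 g = g.num.trailingCoeff / g.denom.trailingCoeff := by
  simp only [c0, Polynomial.rootMultiplicity_eq_natTrailingDegree', Polynomial.trailingCoeff]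

theorem aux_c0_mul (g h : (RatFunc ℂ)ˣ) :
    c0 ((g * h : (RatFunc ℂ)ˣ) : RatFunc ℂ) = c0 g * c0 h := by
  have key := RatFunc.num_denom_mul (g : RatFunc ℂ) (h : RatFunc ℂ)
  have h1 := congrArg Polynomial.trailingCoeff key
  have nz : ∀ p : ℂ[X], p ≠ 0 → p.trailingCoeff ≠ 0 := fun p hp hh =>
    hp (Polynomial.trailingCoeff_eq_zero.1 hh)
  have dg := nz _ (RatFunc.denom_ne_zero (g : RatFunc ℂ))
  have dh := nz _ (RatFunc.denom_ne_zero (h : RatFunc ℂ))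
  have dgh := nz _ (RatFunc.denom_ne_zero ((g : RatFunc ℂ) * (h : RatFunc ℂ)))
  simp only [Polynomial.trailingCoeff_mul] at h1
  simp only [aux_c0_eq, Units.val_mul]
  rw [div_mul_div_comm, div_eq_div_iff dgh (mul_ne_zero dg dh)]
  exact h1

theorem aux_ordAt_one (x : ℂ) : ordAt x (1 : RatFunc ℂ) = 0 := by
  simp [ordAt]

noncomputable def ordH (x : ℂ) : (RatFunc ℂ)ˣ →* Multiplicative ℤ where
  toFun g := Multiplicative.ofAdd (ordAt x g)
  map_one' := by simp [aux_ordAt_one]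
  map_mul' g h := by rw [aux_ordAt_mul]; rfl

noncomputable def degH : (RatFunc ℂ)ˣ →* Multiplicative ℤ where
  toFun g := Multiplicative.ofAdd ((g : RatFunc ℂ).intDegree)
  map_one' := by simp
  map_mul' g h := by
    rw [Units.val_mul, RatFunc.intDegree_mul g.ne_zero h.ne_zero]; rfl

noncomputable def cInfH : (RatFunc ℂ)ˣ →* ℂ where
  toFun g := cInf g
  map_one' := by simp [cInf]
  map_mul' := aux_cInf_mul

noncomputable def c0H : (RatFunc ℂ)ˣ →* ℂ where
  toFun g := c0 g
  map_one' := by simp [aux_c0_eq]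
  map_mul' := aux_c0_mul

/-- linear factor -/
noncomputable def linU (x : ℂ) : (RatFunc ℂ)ˣ :=
  Units.mk0 (algebraMap ℂ[X] (RatFunc ℂ) (X - C x))
    (RatFunc.algebraMap_ne_zero (Polynomial.X_sub_C_ne_zero x))

noncomputable def conU (a : ℂˣ) : (RatFunc ℂ)ˣ :=
  Units.map (RatFunc.C : ℂ →+* RatFunc ℂ).toMonoidHom a

theorem conU_val (a : ℂˣ) :
    ((conU a : (RatFunc ℂ)ˣ) : RatFunc ℂ) = algebraMap ℂ[X] (RatFunc ℂ) (C (a : ℂ)) := by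
  simp [conU]

theorem ordH_lin (x y : ℂ) : ordH y (linU x) = Multiplicative.ofAdd (if y = x then 1 else 0) := by
  simp only [ordH, linU, MonoidHom.coe_mk, OneHom.coe_mk, Units.val_mk0, ordAt,
    RatFunc.num_algebraMap, RatFunc.denom_algebraMap, Polynomial.rootMultiplicity_X_sub_C]
  split_ifs <;> simp

theorem ordH_con (a : ℂˣ) (y : ℂ) : ordH y (conU a) = 1 := by
  simp only [ordH, MonoidHom.coe_mk, OneHom.coe_mk, conU_val, ordAt,
    RatFunc.num_algebraMap, RatFunc.denom_algebraMap]
  simp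

theorem degH_lin (x : ℂ) : degH (linU x) = Multiplicative.ofAdd 1 := by
  simp only [degH, linU, MonoidHom.coe_mk, OneHom.coe_mk, Units.val_mk0,
    RatFunc.intDegree_polynomial, Polynomial.natDegree_X_sub_C]
  rfl

theorem degH_con (a : ℂˣ) : degH (conU a) = 1 := by
  simp only [degH, MonoidHom.coe_mk, OneHom.coe_mk, conU_val,
    RatFunc.intDegree_polynomial, Polynomial.natDegree_C]
  rfl

theorem cInfH_lin (x : ℂ) : cInfH (linU x) = 1 := by
  simp only [cInfH, MonoidHom.coe_mk, OneHom.coe_mk, linU, cInf, Units.val_mk0,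
    RatFunc.num_algebraMap, RatFunc.denom_algebraMap]
  simp

theorem cInfH_con (a : ℂˣ) : cInfH (conU a) = a := by
  simp only [cInfH, MonoidHom.coe_mk, OneHom.coe_mk, conU_val, cInf,
    RatFunc.num_algebraMap, RatFunc.denom_algebraMap]
  simp

theorem aux_rm1 : Polynomial.rootMultiplicity (0 : ℂ) (1 : ℂ[X]) = 0 := by
  simpa using Polynomial.rootMultiplicity_C (1 : ℂ) 0

theorem c0H_con (a : ℂˣ) : c0H (conU a) = a := by
  simp only [c0H, MonoidHom.coe_mk, OneHom.coe_mk, conU_val, c0,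
    RatFunc.num_algebraMap, RatFunc.denom_algebraMap]
  simp [aux_rm1]

theorem c0H_lin (x : ℂˣ) : c0H (linU x) = -x := by
  simp only [c0H, MonoidHom.coe_mk, OneHom.coe_mk, linU, c0, Units.val_mk0,
    RatFunc.num_algebraMap, RatFunc.denom_algebraMap, Polynomial.rootMultiplicity_X_sub_C]
  simp [aux_rm1, x.ne_zero.symm]

theorem c0H_X : c0H (linU 0) = 1 := by
  simp only [c0H, MonoidHom.coe_mk, OneHom.coe_mk, linU, c0, Units.val_mk0,
    RatFunc.num_algebraMap, RatFunc.denom_algebraMap, Polynomial.rootMultiplicity_X_sub_C]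
  simp [aux_rm1]

/-- standard form -/
noncomputable def stdU (a : ℂˣ) (n : ℤ) (S : Finset ℂˣ) (f : ℂˣ → ℤ) : (RatFunc ℂ)ˣ :=
  conU a * linU 0 ^ n * ∏ x ∈ S, linU (x : ℂ) ^ f x

theorem std_ord (a : ℂˣ) (n : ℤ) (S : Finset ℂˣ) (f : ℂˣ → ℤ) (y : ℂˣ) :
    ordAt (y : ℂ) (stdU a n S f : RatFunc ℂ) = if y ∈ S then f y else 0 := by
  have : ordH y (stdU a n S f) = Multiplicative.ofAdd (if y ∈ S then f y else 0) := by
    classical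
    simp only [stdU, map_mul, map_zpow, map_prod, ordH_con, ordH_lin, y.ne_zero, if_false,
      Units.val_inj, ← ofAdd_zsmul, ← ofAdd_sum]
    simp
  exact Multiplicative.ofAdd.injective this

theorem std_ord0 (a : ℂˣ) (n : ℤ) (S : Finset ℂˣ) (f : ℂˣ → ℤ) :
    ord0 (stdU a n S f : RatFunc ℂ) = n := by
  have : ordH 0 (stdU a n S f) = Multiplicative.ofAdd n := by
    simp only [stdU, map_mul, map_zpow, map_prod, ordH_con, ordH_lin, Units.ne_zero, if_false,
      (Units.ne_zero _).symm, ← ofAdd_zsmul, ← ofAdd_sum]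
    simp
  exact Multiplicative.ofAdd.injective this

theorem std_deg (a : ℂˣ) (n : ℤ) (S : Finset ℂˣ) (f : ℂˣ → ℤ) :
    (stdU a n S f : RatFunc ℂ).intDegree = n + ∑ x ∈ S, f x := by
  have : degH (stdU a n S f) = Multiplicative.ofAdd (n + ∑ x ∈ S, f x) := by
    simp only [stdU, map_mul, map_zpow, map_prod, degH_con, degH_lin,
      ← ofAdd_zsmul, ← ofAdd_sum]
    simp
  exact Multiplicative.ofAdd.injective this

theorem std_cInf (a : ℂˣ) (n : ℤ) (S : Finset ℂˣ) (f : ℂˣ → ℤ) :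
    cInf (stdU a n S f : RatFunc ℂ) = a := by
  change cInfH _ = _
  simp [stdU, map_mul, map_zpow, map_prod, cInfH_con, cInfH_lin]

theorem std_c0 (a : ℂˣ) (n : ℤ) (S : Finset ℂˣ) (f : ℂˣ → ℤ) :
    c0 (stdU a n S f : RatFunc ℂ) = ((a * ∏ x ∈ S, (-x) ^ f x : ℂˣ) : ℂ) := by
  change c0H _ = _
  simp [stdU, map_mul, map_zpow, map_prod, c0H_con, c0H_lin, c0H_X]

theorem aux_noroot (g : RatFunc ℂ) (hg : g ≠ 0) (h : ∀ x, ordAt x g = 0) (x : ℂ) :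
    ¬ g.num.IsRoot x ∧ ¬ g.denom.IsRoot x := by
  have h1 := Polynomial.rootMultiplicity_pos (RatFunc.num_ne_zero hg) (x := x)
  have h2 := Polynomial.rootMultiplicity_pos (RatFunc.denom_ne_zero g) (x := x)
  have h3 := h x
  simp only [ordAt] at h3
  have h4 : g.num.IsRoot x ↔ g.denom.IsRoot x := by
    rw [← h1, ← h2]; omega
  have h5 : ¬ (g.num.IsRoot x ∧ g.denom.IsRoot x) := by
    rintro ⟨ha, hb⟩
    obtain ⟨u, v, huv⟩ := RatFunc.isCoprime_num_denom g
    have := congrArg (Polynomial.eval x) huv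
    simp [ha.eq_zero, hb.eq_zero] at this
  tauto

theorem aux_const (g : (RatFunc ℂ)ˣ) (h : ∀ x, ordAt x (g : RatFunc ℂ) = 0) :
    (g : RatFunc ℂ) = RatFunc.C (cInf g) := by
  have hn : (g : RatFunc ℂ).num.degree = 0 := by
    by_contra hd
    obtain ⟨x, hx⟩ := Complex.isAlgClosed.exists_root _ hd
    exact (aux_noroot g g.ne_zero h x).1 hx
  have hd : (g : RatFunc ℂ).denom.degree = 0 := by
    by_contra hd
    obtain ⟨x, hx⟩ := Complex.isAlgClosed.exists_root _ hd
    exact (aux_noroot g g.ne_zero h x).2 hx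
  have e1 := Polynomial.eq_C_of_degree_eq_zero hn
  have e2 := Polynomial.eq_C_of_degree_eq_zero hd
  conv_lhs => rw [← RatFunc.num_div_denom (g : RatFunc ℂ)]
  rw [cInf, e1, e2]
  simp

theorem aux_cInf_ne (g : (RatFunc ℂ)ˣ) : cInf (g : RatFunc ℂ) ≠ 0 := by
  have dg := Polynomial.leadingCoeff_ne_zero.2 (RatFunc.denom_ne_zero (g : RatFunc ℂ))
  have ng := Polynomial.leadingCoeff_ne_zero.2 (aux_num_ne g)
  exact div_ne_zero ng dg

theorem aux_std (g : (RatFunc ℂ)ˣ) (S : Finset ℂˣ) (f : ℂˣ → ℤ)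
    (h : ∀ x : ℂˣ, ordAt (x : ℂ) (g : RatFunc ℂ) = if x ∈ S then f x else 0) :
    g = stdU (Units.mk0 (cInf g) (aux_cInf_ne g)) (ord0 g) S f := by
  set s := stdU (Units.mk0 (cInf g) (aux_cInf_ne g)) (ord0 g) S f with hs
  have hq : ∀ x, ordAt x ((g * s⁻¹ : (RatFunc ℂ)ˣ) : RatFunc ℂ) = 0 := by
    intro x
    have : ordH x g = ordH x s := by
      by_cases hx : x = 0
      · subst hx
        have := std_ord0 (Units.mk0 (cInf g) (aux_cInf_ne g)) (ord0 g) S f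
        rw [← hs] at this
        exact congrArg Multiplicative.ofAdd this.symm
      · have h1 := std_ord (Units.mk0 (cInf g) (aux_cInf_ne g)) (ord0 g) S f (Units.mk0 x hx)
        rw [← hs, ← h] at h1
        exact congrArg Multiplicative.ofAdd h1.symm
    have h2 : ordH x (g * s⁻¹) = Multiplicative.ofAdd 0 := by
      rw [map_mul, map_inv, this]; simp
    exact Multiplicative.ofAdd.injective h2
  have hc : cInf ((g * s⁻¹ : (RatFunc ℂ)ˣ) : RatFunc ℂ) = 1 := by
    have h1 : cInfH s = cInfH g := by
      have := std_cInf (Units.mk0 (cInf g) (aux_cInf_ne g)) (ord0 g) S f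
      rw [← hs] at this
      exact this
    change cInfH _ = 1
    rw [map_mul, ← h1, ← map_mul]; simp
  have h3 := aux_const _ hq
  rw [hc, map_one] at h3
  have h4 : g * s⁻¹ = 1 := Units.ext h3
  exact mul_inv_eq_one.1 h4

theorem aux_cyc {A : Type*} (m : ℕ) [NeZero m] (f : ZMod m → A) (h : ∀ j, f j = f (j + 1))
    (j : ZMod m) : f j = f 0 := by
  have : ∀ k : ℕ, f (k : ZMod m) = f 0 := by
    intro k
    induction k with
    | zero => simp
    | succ k ih => rw [← ih, h (k : ZMod m)]; simp
  simpa using this j.val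

theorem aux_sum_shift {A : Type*} [AddCommMonoid A] (m : ℕ) [NeZero m] (f : ZMod m → A) :
    ∑ j, f (j + 1) = ∑ j, f j :=
  Equiv.sum_comp (Equiv.addRight (1 : ZMod m)) f

theorem aux_pot {A : Type*} [AddCommGroup A] (m : ℕ) [NeZero m] (d : ZMod m → A)
    (h : ∑ j, d j = 0) : ∃ n : ZMod m → A, ∀ j, n (j + 1) = n j + d j := by
  have hsum : ∑ i ∈ Finset.range m, d (i : ZMod m) = 0 := by
    rw [← h]
    refine Finset.sum_bij' (fun i _ => (i : ZMod m)) (fun j _ => j.val) ?_ ?_ ?_ ?_ ?_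
    · simp
    · intro j _; simpa using ZMod.val_lt j
    · intro i hi; exact ZMod.val_cast_of_lt (Finset.mem_range.1 hi)
    · simp
    · simp
  refine ⟨fun j => ∑ i ∈ Finset.range j.val, d (i : ZMod m), fun j => ?_⟩
  have e : ∑ i ∈ Finset.range j.val, d (i : ZMod m) + d j
      = ∑ i ∈ Finset.range (j.val + 1), d (i : ZMod m) := by
    rw [Finset.sum_range_succ]; simp
  simp only [e]
  have ej : j + 1 = ((j.val + 1 : ℕ) : ZMod m) := by simp
  rcases Nat.lt_or_ge (j.val + 1) m with hl | hl
  · rw [ej, ZMod.val_cast_of_lt hl]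
  · have : j.val + 1 = m := le_antisymm (ZMod.val_lt j) hl
    rw [ej, this, hsum]; simp

theorem aux_weight (m : ℕ) [NeZero m] (n d : ZMod m → ℤ) (h : ∀ j, n (j + 1) = n j + d j) :
    ∑ j : ZMod m, (d j : ZMod m) * j = - ((∑ j, n j : ℤ) : ZMod m) := by
  have h1 : ∀ j, (d j : ZMod m) * j
      = ((n (j + 1) : ZMod m) * (j + 1) - (n (j + 1) : ZMod m)) - (n j : ZMod m) * j := by
    intro j; rw [h j]; push_cast; ring
  simp only [h1, Finset.sum_sub_distrib]
  rw [aux_sum_shift m (fun j => (n j : ZMod m) * j), aux_sum_shift m (fun j => (n j : ZMod m))]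
  push_cast; ring

theorem aux_pot0 (m : ℕ) [NeZero m] (d : ZMod m → ℤ) (h : ∑ j, d j = 0)
    (hw : ∑ j : ZMod m, (d j : ZMod m) * j = 0) :
    ∃ n : ZMod m → ℤ, (∀ j, n (j + 1) = n j + d j) ∧ ∑ j, n j = 0 := by
  obtain ⟨n, hn⟩ := aux_pot m d h
  have h1 := aux_weight m n d hn
  rw [hw, eq_comm, neg_eq_zero, ZMod.intCast_zmod_eq_zero_iff_dvd] at h1
  obtain ⟨t, ht⟩ := h1
  refine ⟨fun j => n j - t, fun j => ?_, ?_⟩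
  · simp only [hn]; ring
  · rw [Finset.sum_sub_distrib, ht]; simp

theorem aux_deg (m : ℕ) [NeZero m] (D : (ℂˣ × Multiplicative (ZMod m)) →₀ ℤ) (S : Finset ℂˣ)
    (hS : ∀ x j, D (x, j) ≠ 0 → x ∈ S) :
    divDeg m D = ∑ j : ZMod m, ∑ x ∈ S, D (x, Multiplicative.ofAdd j) := by
  rw [Finset.sum_comm, divDeg]
  rw [Finset.sum_subset (s₂ := S ×ˢ Finset.univ)]
  · rw [Finset.sum_product]
    exact Finset.sum_congr rfl fun x _ =>
      (Equiv.sum_comp Multiplicative.ofAdd (fun y => D (x, y))).symm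
  · rintro ⟨x, j⟩ hx; simpa using hS x j (Finsupp.mem_support_iff.1 hx)
  · intro p _ hp; simpa using hp

theorem aux_Phi (m : ℕ) [NeZero m] (D : (ℂˣ × Multiplicative (ZMod m)) →₀ ℤ) (S : Finset ℂˣ)
    (hS : ∀ x j, D (x, j) ≠ 0 → x ∈ S) :
    Phi m D = (∏ j : ZMod m, ∏ x ∈ S, x ^ D (x, Multiplicative.ofAdd j),
      Multiplicative.ofAdd (∑ j : ZMod m,
        ((∑ x ∈ S, D (x, Multiplicative.ofAdd j) : ℤ) : ZMod m) * j)) := by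
  have : Phi m D = ∏ j : ZMod m, ∏ x ∈ S,
      ((x, Multiplicative.ofAdd j) : ℂˣ × Multiplicative (ZMod m)) ^
        D (x, Multiplicative.ofAdd j) := by
    rw [Finset.prod_comm, Phi]
    rw [Finset.prod_subset (s₂ := S ×ˢ Finset.univ)]
    · rw [Finset.prod_product]
      exact Finset.prod_congr rfl fun x _ =>
        (Equiv.prod_comp Multiplicative.ofAdd (fun y => (x, y) ^ D (x, y))).symm
    · rintro ⟨x, j⟩ hx; simpa using hS x j (Finsupp.mem_support_iff.1 hx)
    · intro p _ hp
      have : D p = 0 := by simpa using hp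
      simp [this]
  rw [this]
  ext1
  · simp [Prod.fst_prod]
  · simp only [Prod.snd_prod, Prod.pow_snd, ← ofAdd_zsmul, ← ofAdd_sum]
    simp [Finset.sum_mul]

theorem aux_sign (m : ℕ) [NeZero m] (D : ZMod m → ℂˣ → ℤ) (S : Finset ℂˣ)
    (h : ∑ j, ∑ x ∈ S, D j x = 0) :
    ∏ j, ∏ x ∈ S, (-x) ^ D j x = ∏ j, ∏ x ∈ S, x ^ D j x := by
  have e : ∀ (x : ℂˣ) (k : ℤ), (-x) ^ k = (-1) ^ k * x ^ k := by
    intro x k; rw [← mul_zpow]; simp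
  have z : ∀ (s : Finset ℂˣ) (f : ℂˣ → ℤ), ∏ x ∈ s, (-1 : ℂˣ) ^ f x = (-1) ^ ∑ x ∈ s, f x := by
    intro s f
    exact (map_sum (zmultiplesHom (Additive ℂˣ) (Additive.ofMul (-1 : ℂˣ))) f s).symm
  have z2 : ∀ (f : ZMod m → ℤ), ∏ x, (-1 : ℂˣ) ^ f x = (-1) ^ ∑ x, f x := by
    intro f
    exact (map_sum (zmultiplesHom (Additive ℂˣ) (Additive.ofMul (-1 : ℂˣ))) f _).symm
  rw [Finset.prod_congr rfl fun j _ => Finset.prod_congr rfl fun x _ => e x (D j x)]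
  simp only [Finset.prod_mul_distrib, z, z2, h]
  simp

end Helpers

/-- Exactness of `0 → ℂ* → 𝒦ₘ → Div₀(ℂ* × ℤ/m) → ℂ* × ℤ/m → 0`: the constants inject
into `𝒦ₘ`, the kernel of `div` is exactly the constants, the image of `div` in the
degree-zero divisors is exactly the kernel of `Φ`, and `Φ` maps the degree-zero divisors
onto `ℂ* × ℤ/m`. -/
theorem Kgroup_exact_sequence (m : ℕ) [NeZero m] :
    (∀ c : ℂˣ, constTuple m c ∈ Kgroup m) ∧
    Function.Injective (fun c : ℂˣ => constTuple m c) ∧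
    (∀ g ∈ Kgroup m,
      ((∀ (x : ℂˣ) (j : ZMod m), ordAt (x : ℂ) ((g j : RatFunc ℂ)) = 0) ↔
        ∃ c : ℂˣ, g = constTuple m c)) ∧
    (∀ D : (ℂˣ × Multiplicative (ZMod m)) →₀ ℤ, divDeg m D = 0 →
      (Phi m D = 1 ↔
        ∃ g ∈ Kgroup m, ∀ (x : ℂˣ) (j : ZMod m),
          D (x, Multiplicative.ofAdd j) = ordAt (x : ℂ) ((g j : RatFunc ℂ)))) ∧
    (∀ P : ℂˣ × Multiplicative (ZMod m),
      ∃ D : (ℂˣ × Multiplicative (ZMod m)) →₀ ℤ, divDeg m D = 0 ∧ Phi m D = P) := by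
  have hKiff : ∀ (g : ZMod m → (RatFunc ℂ)ˣ) (S : Finset ℂˣ) (a : ZMod m → ℂˣ) (n : ZMod m → ℤ)
      (f : ZMod m → ℂˣ → ℤ), (∀ j, g j = stdU (a j) (n j) S (f j)) →
      (g ∈ Kgroup m ↔ (∀ j, n (j + 1) = n j + ∑ x ∈ S, f j x) ∧
        (∀ j, a j = a (j + 1) * ∏ x ∈ S, (-x) ^ f (j + 1) x) ∧ ∑ j, n j = 0) := by
    intro g S a n f hg
    simp only [Kgroup, Set.mem_setOf_eq, hg, ordInf, std_deg, std_ord0, std_cInf, std_c0,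
      Units.val_inj]
    refine and_congr (forall_congr' fun j => ?_) Iff.rfl
    constructor <;> intro h <;> linarith
  have hconst : ∀ c : ℂˣ, ∀ j, constTuple m c j = stdU c 0 ∅ (fun _ => 0) := by
    intro c j
    simp [constTuple, stdU, conU]
  refine ⟨?_, ?_, ?_, ?_, ?_⟩
  · intro c
    rw [hKiff _ ∅ (fun _ => c) (fun _ => 0) (fun _ _ => 0) (hconst c)]
    simp
  · intro c c' h
    have h1 := congrFun h 0
    simp only [constTuple] at h1
    have h2 := congrArg (Units.val) h1
    simp only [Units.coe_map] at h2
    exact Units.ext (RatFunc.C_injective h2)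
  · intro g hg
    constructor
    · intro h
      have hs : ∀ j, g j = _ := fun j => aux_std (g j) ∅ (fun _ => 0) (by simpa using fun x => h x j)
      obtain ⟨h1, h2, h3⟩ := (hKiff g ∅ _ _ (fun _ _ => 0) hs).1 hg
      simp only [Finset.sum_empty, add_zero, Finset.prod_empty, mul_one] at h1 h2
      have h4 := aux_cyc m _ (fun j => (h1 j).symm)
      have h5 := aux_cyc m _ h2
      have h6 : ord0 (g 0 : RatFunc ℂ) = 0 := by
        simp only [h4, Finset.sum_const, smul_eq_mul] at h3
        simpa [NeZero.ne m] using h3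
      refine ⟨Units.mk0 _ (aux_cInf_ne (g 0)), ?_⟩
      funext j
      rw [hconst, hs j, h4 j, h5 j, h6]
    · rintro ⟨c, rfl⟩ x j
      rw [hconst, std_ord]; simp
  · intro D hD
    classical
    set S : Finset ℂˣ := D.support.image Prod.fst with hSdef
    have hS : ∀ x j, D (x, j) ≠ 0 → x ∈ S := fun x j h =>
      Finset.mem_image.2 ⟨(x, j), Finsupp.mem_support_iff.2 h, rfl⟩
    rw [aux_deg m D S hS] at hD
    have hsign := aux_sign m (fun j x => D (x, Multiplicative.ofAdd j)) S hD
    have hif : ∀ (x : ℂˣ) (j : ZMod m), D (x, Multiplicative.ofAdd j)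
        = if x ∈ S then D (x, Multiplicative.ofAdd j) else 0 := by
      intro x j
      split_ifs with hx
      · rfl
      · by_contra h0; exact hx (hS _ _ h0)
    rw [aux_Phi m D S hS, ← hsign, Prod.mk_eq_one, ofAdd_eq_one]
    constructor
    · rintro ⟨hP, hw⟩
      obtain ⟨n, hn, hn0⟩ := aux_pot0 m _ hD hw
      obtain ⟨b, hb⟩ := aux_pot (A := Additive ℂˣ) m
        (fun j => Additive.ofMul (∏ x ∈ S, (-x) ^ D (x, Multiplicative.ofAdd (j + 1)))⁻¹) (by
          rw [aux_sum_shift m (fun j => Additive.ofMul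
            (∏ x ∈ S, (-x) ^ D (x, Multiplicative.ofAdd j))⁻¹), ← ofMul_prod,
            Finset.prod_inv_distrib, hP]
          simp)
      refine ⟨fun j => stdU (b j).toMul (n j) S (fun x => D (x, Multiplicative.ofAdd j)), ?_, ?_⟩
      · rw [hKiff _ S (fun j => (b j).toMul) n (fun j x => D (x, Multiplicative.ofAdd j))
          (fun j => rfl)]
        refine ⟨hn, fun j => ?_, hn0⟩
        rw [hb j]
        simp only [toMul_add, toMul_ofMul, inv_mul_cancel_right]
      · intro x j
        rw [std_ord]; exact hif x j
    · rintro ⟨g, hg, h⟩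
      have hs : ∀ j, g j = _ := fun j => aux_std (g j) S
        (fun x => D (x, Multiplicative.ofAdd j)) (fun x => by rw [← h]; exact hif x j)
      obtain ⟨h1, h2, h3⟩ := (hKiff g S _ _ _ hs).1 hg
      constructor
      · have h4 := Finset.prod_congr (rfl : (Finset.univ : Finset (ZMod m)) = Finset.univ)
          (fun j _ => h2 j)
        rw [Finset.prod_mul_distrib] at h4
        have h5 := fun f : ZMod m → ℂˣ => Equiv.prod_comp (Equiv.addRight (1 : ZMod m)) f
        simp only [Equiv.coe_addRight] at h5
        rw [h5 (fun j => Units.mk0 (cInf (g j : RatFunc ℂ)) (aux_cInf_ne (g j))),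
          h5 (fun j => ∏ x ∈ S, (-x) ^ D (x, Multiplicative.ofAdd j))] at h4
        exact left_eq_mul.1 h4
      · rw [aux_weight m (fun j => ord0 (g j : RatFunc ℂ)) _ h1, h3]; simp
  · intro P
    refine ⟨Finsupp.single P 1 + Finsupp.single 1 (-1), ?_, ?_⟩
    · change Finsupp.sum _ (fun _ k => k) = 0
      rw [Finsupp.sum_add_index' (by simp) (by simp), Finsupp.sum_single_index rfl,
        Finsupp.sum_single_index rfl]
      simp
    · change Finsupp.prod _ (fun p k => p ^ k) = P
      rw [Finsupp.prod_add_index' (by simp) (fun a => zpow_add a),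
        Finsupp.prod_single_index (by simp), Finsupp.prod_single_index (by simp)]
      simp
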